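/- Let V be a finite type, w : V → ℝ, and G a nonempty finite set of bijections g : V ≃ V. Set w̃(v,g) = (w(v) + w(g(v)))/2. Assume ∑_{v∈V} w(v) ≥ 0, ∑_{v∈V} |w(v)| > 0, and ∑_{g∈G} ∑_{v∈V} |w̃(v,g)| > 0. Then (∑_{g∈G} ∑_{v∈V} sign(w̃(v,g))·|w̃(v,g)|) / (∑_{g∈G} ∑_{v∈V} |w̃(v,g)|) ≥ (∑_{v∈V} sign(w(v))·|w(v)|) / (∑_{v∈V} |w(v)|), i.e. the average sign with respect to the distribution |w̃| is at least the average sign with respect to |w|. -/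

import Mathlib

theorem Real.sign_mul_abs_self (x : ℝ) : Real.sign x * |x| = x := by
  rcases lt_trichotomy x 0 with hx | rfl | hx
  · rw [Real.sign_of_neg hx, abs_of_neg hx]; ring
  · simp
  · rw [Real.sign_of_pos hx, abs_of_pos hx, one_mul]

theorem sum_combined_weight {V : Type*} [Fintype V] (w : V → ℝ) (g : V ≃ V) :
    ∑ v : V, (w v + w (g v)) / 2 = ∑ v : V, w v := by
  rw [← Finset.sum_div, Finset.sum_add_distrib, Equiv.sum_comp g w]
  ring

theorem sum_abs_combined_weight_le {V : Type*} [Fintype V] (w : V → ℝ) (g : V ≃ V) :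
    ∑ v : V, |(w v + w (g v)) / 2| ≤ ∑ v : V, |w v| := by
  rw [← sum_combined_weight (fun v => |w v|) g]
  refine Finset.sum_le_sum fun v _ => ?_
  rw [abs_div, abs_two]
  gcongr
  exact abs_add_le _ _

/-- Inequality (33): the average sign with respect to the distribution `|w̃|`
is at least the average sign with respect to `|w|`. -/
theorem average_sign_combined_ge {V : Type*} [Fintype V]
    (w : V → ℝ) (G : Finset (V ≃ V)) (hG : G.Nonempty)
    (h1 : 0 ≤ ∑ v : V, w v) (h2 : 0 < ∑ v : V, |w v|)
    (h3 : 0 < ∑ g ∈ G, ∑ v : V, |(w v + w (g v)) / 2|) :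
    (∑ v : V, Real.sign (w v) * |w v|) / (∑ v : V, |w v|) ≤
      (∑ g ∈ G, ∑ v : V, Real.sign ((w v + w (g v)) / 2) * |(w v + w (g v)) / 2|) /
        (∑ g ∈ G, ∑ v : V, |(w v + w (g v)) / 2|) := by
  simp only [Real.sign_mul_abs_self, sum_combined_weight, Finset.sum_const, nsmul_eq_mul]
  have hD : ∑ g ∈ G, ∑ v : V, |(w v + w (g v)) / 2| ≤ G.card * ∑ v : V, |w v| := by
    simpa only [Finset.sum_const, nsmul_eq_mul] using
      Finset.sum_le_sum fun g (_ : g ∈ G) => sum_abs_combined_weight_le w g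
  rw [div_le_div_iff₀ h2 h3]
  calc (∑ v : V, w v) * ∑ g ∈ G, ∑ v : V, |(w v + w (g v)) / 2|
      ≤ (∑ v : V, w v) * (G.card * ∑ v : V, |w v|) := mul_le_mul_of_nonneg_left hD h1
    _ = G.card * (∑ v : V, w v) * ∑ v : V, |w v| := by ring
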